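/- Consider a trajectory of the opinion dynamics system (2.1) in which, for every agent i and time t, the median m_i(t) is additionally chosen closest to x_i(t) (i.e., |m_i(t) − x_i(t)| ≤ |z − x_i(t)| for every weighted median z of x(t) with respect to the i-th row of W). If P ⊆ V₂ is a cohesive influential cluster consisting only of unopinionated agents, then for every i ∈ P and every t ∈ ℕ: min_{j∈P} x_j(0) ≤ x_i(t) ≤ max_{j∈P} x_j(0). -/

import Mathlib

open Filter Topology

def IsWeightVec {n : ℕ} (w : Fin n → ℝ) : Prop :=
  (∀ j, 0 ≤ w j) ∧ (∑ j, w j) = 1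

def IsWMedian {n : ℕ} (w : Fin n → ℝ) (x : Fin n → ℝ) (a : ℝ) : Prop :=
  (∑ j ∈ Finset.univ.filter (fun j => x j < a), w j) ≤ 1 / 2 ∧
  (∑ j ∈ Finset.univ.filter (fun j => a < x j), w j) ≤ 1 / 2

def RowStochastic {m n : ℕ} (A : Matrix (Fin m) (Fin n) ℝ) : Prop :=
  ∀ i, IsWeightVec (A i)

/-- A nonempty `P ⊆ V` is a cohesive agent set if every member places at least
half of its total weight inside `P`. -/
def CohesiveAgentSet {n : ℕ} (W : Matrix (Fin n) (Fin n) ℝ) (P : Finset (Fin n)) : Prop :=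
  P.Nonempty ∧ ∀ i ∈ P, 1 / 2 ≤ ∑ j ∈ P, W i j

/-- A nonempty `Q` is a strong cohesive group set relative to `P` if every simplex of `Q`
is composed only of agents of `P` and every agent places more than half of its
environmental weight on `Q`. -/
def StrongCohesiveGroupSet {n l : ℕ} (M : Matrix (Fin n) (Fin l) ℝ)
    (A : Matrix (Fin l) (Fin n) ℝ) (P : Finset (Fin n)) (Q : Finset (Fin l)) : Prop :=
  Q.Nonempty ∧ (∀ k ∈ Q, ∀ j, j ∉ P → A k j = 0) ∧ ∀ i, 1 / 2 < ∑ k ∈ Q, M i k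

/-- `P` is a cohesive influential cluster if it is a cohesive agent set admitting a
strong cohesive group set relative to it. -/
def CohesiveInfluentialCluster {n l : ℕ} (W : Matrix (Fin n) (Fin n) ℝ)
    (M : Matrix (Fin n) (Fin l) ℝ) (A : Matrix (Fin l) (Fin n) ℝ)
    (P : Finset (Fin n)) : Prop :=
  CohesiveAgentSet W P ∧ ∃ Q : Finset (Fin l), StrongCohesiveGroupSet M A P Q

/-- A trajectory of system (2.1) in which every agent additionally breaks ties in the
agent-opinion weighted median by choosing the one closest to its own current opinion. -/
def IsTrajectoryClosest {n l : ℕ} (lam γ : Fin n → ℝ) (u : ℝ)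
    (W : Matrix (Fin n) (Fin n) ℝ) (M : Matrix (Fin n) (Fin l) ℝ)
    (A : Matrix (Fin l) (Fin n) ℝ) (x : ℕ → Fin n → ℝ) : Prop :=
  ∀ t i, ∃ m mhat : ℝ,
    IsWMedian (W i) (x t) m ∧
    (∀ z, IsWMedian (W i) (x t) z → |m - x t i| ≤ |z - x t i|) ∧
    IsWMedian (M i) (A.mulVec (x t)) mhat ∧
    x (t + 1) i = lam i * u + (1 - lam i) * ((1 - γ i) * m + γ i * mhat)

theorem IsWMedian.neg {n : ℕ} {w x : Fin n → ℝ} {a : ℝ} (h : IsWMedian w x a) :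
    IsWMedian w (-x) (-a) := by
  simpa [IsWMedian, and_comm] using h

theorem sum_le_half_of_subset {n : ℕ} {w : Fin n → ℝ} (hw : IsWeightVec w)
    {S T : Finset (Fin n)} (h : S ⊆ T) (hT : ∑ j ∈ T, w j ≤ 1 / 2) : ∑ j ∈ S, w j ≤ 1 / 2 :=
  (Finset.sum_le_sum_of_subset_of_nonneg h fun j _ _ => hw.1 j).trans hT

/-- A lower bound for the entries on a set of weight more than one half bounds every weighted
median. -/
theorem IsWMedian.le_of_half_lt {n : ℕ} {w x : Fin n → ℝ} {m a : ℝ} (hw : IsWeightVec w)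
    (hm : IsWMedian w x m) {Q : Finset (Fin n)} (hQ : 1 / 2 < ∑ j ∈ Q, w j)
    (ha : ∀ j ∈ Q, a ≤ x j) : a ≤ m := by
  by_contra! hlt
  refine hQ.not_ge (sum_le_half_of_subset hw (fun j hj => ?_) hm.2)
  simpa using hlt.trans_le (ha j hj)

/-- A lower bound for the entries on a set of weight at least one half bounds the weighted median
closest to any point satisfying the same bound. -/
theorem IsWMedian.le_of_half_le_of_closest {n : ℕ} {w x : Fin n → ℝ} {m a y : ℝ}
    (hw : IsWeightVec w) (hm : IsWMedian w x m)
    (hclosest : ∀ z, IsWMedian w x z → |m - y| ≤ |z - y|)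
    {P : Finset (Fin n)} (hP : 1 / 2 ≤ ∑ j ∈ P, w j) (ha : ∀ j ∈ P, a ≤ x j) (hy : a ≤ y) :
    a ≤ m := by
  by_contra! hlt
  have hcompl : ∑ j ∈ Pᶜ, w j ≤ 1 / 2 := by
    have := Finset.sum_add_sum_compl P w
    linarith [hw.2]
  have hmed : IsWMedian w x a := by
    refine ⟨sum_le_half_of_subset hw (fun j hj => ?_) hcompl,
      sum_le_half_of_subset hw (fun j hj => ?_) hm.2⟩
    · rw [Finset.mem_compl]
      exact fun hjP => (Finset.mem_filter.1 hj).2.not_ge (ha j hjP)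
    · simpa using hlt.trans (Finset.mem_filter.1 hj).2
  have h := hclosest a hmed
  rw [abs_of_nonpos (by linarith), abs_of_nonpos (by linarith)] at h
  linarith

/-- A weighted average only sees the entries on the support of the weights. -/
theorem IsWeightVec.le_dotProduct {n : ℕ} {w x : Fin n → ℝ} {a : ℝ} (hw : IsWeightVec w)
    {P : Finset (Fin n)} (hsupp : ∀ j, j ∉ P → w j = 0) (ha : ∀ j ∈ P, a ≤ x j) :
    a ≤ w ⬝ᵥ x := by
  calc a = ∑ j, w j * a := by rw [← Finset.sum_mul, hw.2, one_mul]
    _ ≤ ∑ j, w j * x j := by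
      refine Finset.sum_le_sum fun j _ => ?_
      by_cases hj : j ∈ P
      · exact mul_le_mul_of_nonneg_left (ha j hj) (hw.1 j)
      · simp [hsupp j hj]

theorem IsTrajectoryClosest.neg {n l : ℕ} {lam γ : Fin n → ℝ} {u : ℝ}
    {W : Matrix (Fin n) (Fin n) ℝ} {M : Matrix (Fin n) (Fin l) ℝ}
    {A : Matrix (Fin l) (Fin n) ℝ} {x : ℕ → Fin n → ℝ}
    (h : IsTrajectoryClosest lam γ u W M A x) :
    IsTrajectoryClosest lam γ (-u) W M A (fun t => -x t) := by
  intro t i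
  obtain ⟨m, mhat, hm, hclosest, hmhat, hx⟩ := h t i
  refine ⟨-m, -mhat, hm.neg, fun z hz => ?_, ?_, ?_⟩
  · have := hclosest (-z) (by simpa using hz.neg)
    rw [← abs_neg, ← abs_neg (z - _)]
    convert this using 2 <;> simp only [Pi.neg_apply] <;> ring
  · rw [Matrix.mulVec_neg]
    exact hmhat.neg
  · simp only [Pi.neg_apply, hx]
    ring

/-- A lower bound for the opinions in a cohesive influential cluster of unopinionated agents
persists along the trajectory. -/
theorem IsTrajectoryClosest.le_of_le_zero {n l : ℕ} {lam γ : Fin n → ℝ} {u : ℝ}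
    {W : Matrix (Fin n) (Fin n) ℝ} {M : Matrix (Fin n) (Fin l) ℝ}
    {A : Matrix (Fin l) (Fin n) ℝ} {x : ℕ → Fin n → ℝ}
    (htraj : IsTrajectoryClosest lam γ u W M A x)
    (hγ : ∀ i, 0 ≤ γ i ∧ γ i ≤ 1)
    (hW : RowStochastic W) (hM : RowStochastic M) (hA : RowStochastic A)
    {P : Finset (Fin n)} (hlam : ∀ i ∈ P, lam i = 0)
    (hP : CohesiveInfluentialCluster W M A P) {a : ℝ} (ha : ∀ i ∈ P, a ≤ x 0 i) (t : ℕ) :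
    ∀ i ∈ P, a ≤ x t i := by
  obtain ⟨⟨-, hPW⟩, Q, -, hQA, hQM⟩ := hP
  induction t with
  | zero => exact ha
  | succ t ih =>
    intro i hi
    obtain ⟨m, mhat, hm, hclosest, hmhat, hx⟩ := htraj t i
    have h₁ : a ≤ m := hm.le_of_half_le_of_closest (hW i) hclosest (hPW i hi) ih (ih i hi)
    have h₂ : a ≤ mhat := hmhat.le_of_half_lt (hM i) (hQM i) fun k hk =>
      (hA k).le_dotProduct (hQA k hk) ih
    rw [hx, hlam i hi]
    nlinarith [mul_le_mul_of_nonneg_left h₁ (sub_nonneg.2 (hγ i).2),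
      mul_le_mul_of_nonneg_left h₂ (hγ i).1]

/-- Lemma 3.4: if $P$ is a cohesive influential cluster consisting only of unopinionated
agents, then every opinion of an agent of $P$ stays between the initial minimum and
maximum over $P$ at all times. -/
theorem stmt7 {n l : ℕ}
    (V₁ V₂ : Finset (Fin n)) (hV : V₂ = V₁ᶜ)
    (lam γ : Fin n → ℝ) (u : ℝ)
    (hlam₁ : ∀ i ∈ V₁, 0 < lam i ∧ lam i ≤ 1)
    (hlam₂ : ∀ i ∈ V₂, lam i = 0)
    (hγ : ∀ i, 0 ≤ γ i ∧ γ i ≤ 1)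
    (W : Matrix (Fin n) (Fin n) ℝ) (M : Matrix (Fin n) (Fin l) ℝ)
    (A : Matrix (Fin l) (Fin n) ℝ)
    (hW : RowStochastic W) (hM : RowStochastic M) (hA : RowStochastic A)
    (x : ℕ → Fin n → ℝ) (htraj : IsTrajectoryClosest lam γ u W M A x)
    (P : Finset (Fin n)) (hPV₂ : P ⊆ V₂)
    (hP : CohesiveAgentSet W P)
    (hQ : ∃ Q : Finset (Fin l), StrongCohesiveGroupSet M A P Q) :
    ∀ i ∈ P, ∀ t : ℕ,
      P.inf' hP.1 (x 0) ≤ x t i ∧ x t i ≤ P.sup' hP.1 (x 0) := by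
  intro i hi t
  have hlam : ∀ i ∈ P, lam i = 0 := fun i hi => hlam₂ i (hPV₂ hi)
  refine ⟨htraj.le_of_le_zero hγ hW hM hA hlam ⟨hP, hQ⟩
    (fun j hj => Finset.inf'_le _ hj) t i hi, neg_le_neg_iff.1 ?_⟩
  exact htraj.neg.le_of_le_zero hγ hW hM hA hlam ⟨hP, hQ⟩
    (fun j hj => neg_le_neg (Finset.le_sup' (x 0) hj)) t i hi
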